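/- arXiv:1701.02316 — 2 statements merged into one kernel-verified Lean document; each statement's English description precedes it below -/
import Mathlib

section
/- For every m ≥ 2 and every j with 1 ≤ j ≤ m−1, the extremal weight projector satisfies t_m ∘ σ_j = σ_j ∘ t_m = t_m; moreover, with the affine transposition σ₀ := d_m⁻¹ ∘ σ₁ ∘ d_m, also t_m ∘ σ₀ = σ₀ ∘ t_m = t_m. -/
open Matrix

noncomputable section

/-- Sign strings `ε ∈ {+,-}^m`; `true` encodes `+` and `false` encodes `-`. -/
abbrev Sgn (m : ℕ) := Fin m → Bool

/-- Endomorphisms of `V^{⊗m}` (`V = ℂ²`), as matrices indexed by sign strings. -/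
abbrev Op (m : ℕ) := Matrix (Sgn m) (Sgn m) ℂ

/-- Linear maps `V^{⊗m} → V^{⊗n}`, as matrices (rows: target, columns: source). -/
abbrev Mor (m n : ℕ) := Matrix (Sgn n) (Sgn m) ℂ

/-- The basis vector `v_ε` of `V^{⊗m}`. -/
def bv {m : ℕ} (ε : Sgn m) : Sgn m → ℂ := fun δ => if δ = ε then 1 else 0

/-- The coefficient of `cap` on `v_a ⊗ v_b`:
`cap (v₋ ⊗ v₊) = 1`, `cap (v₊ ⊗ v₋) = -1`, `cap (v₊ ⊗ v₊) = cap (v₋ ⊗ v₋) = 0`. -/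
def capc (a b : Bool) : ℂ := if a then (if b then 0 else -1) else (if b then 1 else 0)

/-- The coefficient of `v_a ⊗ v_b` in `cup 1 = v₊ ⊗ v₋ - v₋ ⊗ v₊`. -/
def cupc (a b : Bool) : ℂ := if a then (if b then 0 else 1) else (if b then -1 else 0)

/-- The cap `V ⊗ V → ℂ`. -/
def capM : Mor 2 0 := Matrix.of fun _ ε => capc (ε 0) (ε 1)

/-- The cup `ℂ → V ⊗ V`. -/
def cupM : Mor 0 2 := Matrix.of fun δ _ => cupc (δ 0) (δ 1)

/-- The tensor product of two linear maps. -/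
def tensMor {a b c d : ℕ} (A : Mor a b) (B : Mor c d) : Mor (a + c) (b + d) :=
  Matrix.of fun δ ε =>
    A (fun i => δ (Fin.castAdd d i)) (fun i => ε (Fin.castAdd c i)) *
      B (fun j => δ (Fin.natAdd b j)) (fun j => ε (Fin.natAdd a j))

/-- The swap of the two tensor factors of `V ⊗ V`. -/
def swap2 : Op 2 := Matrix.of fun δ ε => if δ 0 = ε 1 ∧ δ 1 = ε 0 then 1 else 0

/-- `id^{⊗p} ⊗ A ⊗ id^{⊗(m-p-2)}`: the operator `A` on two strands placed at the
(0-based) positions `p`, `p+1` among `m` strands. -/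
def atPos (m p : ℕ) (A : Op 2) : Op m :=
  Matrix.of fun δ ε =>
    if h : p + 2 ≤ m then
      (if ∀ k : Fin m, k.val ≠ p → k.val ≠ p + 1 → δ k = ε k then 1 else 0) *
        A (fun i => δ ⟨p + i.val, Nat.lt_of_lt_of_le (Nat.add_lt_add_left i.isLt p) h⟩)
          (fun i => ε ⟨p + i.val, Nat.lt_of_lt_of_le (Nat.add_lt_add_left i.isLt p) h⟩)
    else 0

/-- Cyclic rotation of sign strings: `(rotIdx δ) k = δ (k+1 mod m)`. -/
def rotIdx {m : ℕ} (δ : Sgn m) : Sgn m := fun k => δ ⟨(k.val + 1) % m, Nat.mod_lt _ k.pos⟩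

/-- The rotation `d_m : V^{⊗m} → V^{⊗m}`, `d_m (v_ε ⊗ w) = i^{ε} (w ⊗ v_ε)`. -/
def dRot : (m : ℕ) → Op m
  | 0 => 1
  | (m + 1) =>
    Matrix.of fun δ' δ =>
      if δ' = rotIdx δ then (if δ 0 then Complex.I else -Complex.I) else 0

/-- The cap-cup generator `u_j` (`j` is 1-based, `1 ≤ j ≤ m-1`);
`u_0 := d_m⁻¹ ∘ u_1 ∘ d_m` is the affine generator. -/
def uFull (m j : ℕ) : Op m :=
  if j = 0 then (dRot m)⁻¹ * atPos m 0 (cupM * capM) * dRot m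
  else atPos m (j - 1) (cupM * capM)

/-- The extremal weight projectors `t_m`, defined by `t₁ = id`,
`t₂ = id + u₁/2 + u₀/2`, and `t_{m+1} = (t_m ⊗ id) ∘ σ_m ∘ (t_m ⊗ id)` for `m ≥ 2`
(with the convention `t₀ = 2·id`). -/
def tP : (m : ℕ) → Op m
  | 0 => (2 : ℂ) • 1
  | 1 => 1
  | 2 => 1 + (2⁻¹ : ℂ) • atPos 2 0 (cupM * capM) +
      (2⁻¹ : ℂ) • ((dRot 2)⁻¹ * atPos 2 0 (cupM * capM) * dRot 2)
  | (m + 3) =>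
    tensMor (tP (m + 2)) (1 : Op 1) * atPos (m + 3) (m + 1) swap2 *
      tensMor (tP (m + 2)) (1 : Op 1)

/-- `n` nested caps `Ca_n : V^{⊗2n} → ℂ`. -/
def CaM (n : ℕ) : Mor (n + n) 0 :=
  Matrix.of fun _ δ =>
    ∏ k : Fin n,
      capc (δ ⟨k.val, Nat.lt_of_lt_of_le k.isLt (Nat.le_add_right n n)⟩)
        (δ ⟨n + n - 1 - k.val,
          Nat.lt_of_le_of_lt (Nat.sub_le _ _)
            (Nat.sub_lt (Nat.lt_of_lt_of_le k.pos (Nat.le_add_right n n)) Nat.one_pos)⟩)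

/-- `n` nested cups `Cu_n : ℂ → V^{⊗2n}`. -/
def CuM (n : ℕ) : Mor 0 (n + n) :=
  Matrix.of fun δ _ =>
    ∏ k : Fin n,
      cupc (δ ⟨k.val, Nat.lt_of_lt_of_le k.isLt (Nat.le_add_right n n)⟩)
        (δ ⟨n + n - 1 - k.val,
          Nat.lt_of_le_of_lt (Nat.sub_le _ _)
            (Nat.sub_lt (Nat.lt_of_lt_of_le k.pos (Nat.le_add_right n n)) Nat.one_pos)⟩)

/-- The canonical identification of sign strings induced by an equality of lengths. -/
def sgnCast {a b : ℕ} (h : a = b) : Sgn a ≃ Sgn b :=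
  Equiv.arrowCongr (finCongr h) (Equiv.refl Bool)

/-- Reindexing of a linear map along equalities of the numbers of strands. -/
def rc {a b c d : ℕ} (h1 : a = b) (h2 : c = d) (A : Mor a c) : Mor b d :=
  Matrix.reindex (sgnCast h2) (sgnCast h1) A

/-- The idempotents `e_{m,n}`:
`e_{1,1} = -u₁/2 - d₂⁻¹ ∘ u₁ ∘ d₂ / 2` and
`e_{m,n} = -(t_m ⊗ t_n) ∘ u_m ∘ (t_m ⊗ t_n)` otherwise. -/
def eP : (m n : ℕ) → Op (m + n)
  | 1, 1 =>
    (-(2⁻¹ : ℂ)) • atPos 2 0 (cupM * capM) +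
      (-(2⁻¹ : ℂ)) • ((dRot 2)⁻¹ * atPos 2 0 (cupM * capM) * dRot 2)
  | m, n =>
    -(tensMor (tP m) (tP n) * atPos (m + n) (m - 1) (cupM * capM) * tensMor (tP m) (tP n))

/-- The projector onto the span of the two extremal weight vectors. -/
def extremalProj (m : ℕ) : Op m :=
  Matrix.diagonal fun δ => if ∀ k l, δ k = δ l then 1 else 0

/-- The phase picked up by `v_δ` under the rotation. -/
def rotPhase {n : ℕ} (δ : Sgn (n + 1)) : ℂ := if δ 0 then Complex.I else -Complex.I

lemma conj_rotPhase_mul_self {n : ℕ} (δ : Sgn (n + 1)) :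
    (starRingEnd ℂ) (rotPhase δ) * rotPhase δ = 1 := by
  unfold rotPhase; split_ifs <;> simp

lemma rotIdx_apply_add_one {n : ℕ} (δ : Sgn (n + 1)) (k : Fin (n + 1)) :
    rotIdx δ k = δ (k + 1) := by
  simp only [rotIdx]
  congr 1
  ext
  simp [Fin.val_add]

lemma rotIdx_injective {n : ℕ} : Function.Injective (rotIdx : Sgn (n + 1) → Sgn (n + 1)) := by
  intro δ ε h
  funext k
  have := congrFun h (k - 1)
  simpa [rotIdx_apply_add_one] using this

lemma dRot_apply {n : ℕ} (δ ε : Sgn (n + 1)) :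
    dRot (n + 1) δ ε = if δ = rotIdx ε then rotPhase ε else 0 := rfl

lemma mul_dRot_apply {n : ℕ} (A : Op (n + 1)) (δ ε : Sgn (n + 1)) :
    (A * dRot (n + 1)) δ ε = A δ (rotIdx ε) * rotPhase ε := by
  simp [Matrix.mul_apply, dRot_apply]

lemma conjTranspose_dRot_mul_apply {n : ℕ} (A : Op (n + 1)) (δ ε : Sgn (n + 1)) :
    ((dRot (n + 1))ᴴ * A) δ ε = (starRingEnd ℂ) (rotPhase δ) * A (rotIdx δ) ε := by
  simp [Matrix.mul_apply, dRot_apply, apply_ite]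

lemma inv_dRot (n : ℕ) : (dRot (n + 1))⁻¹ = (dRot (n + 1))ᴴ := by
  refine Matrix.inv_eq_left_inv ?_
  ext δ ε
  rw [conjTranspose_dRot_mul_apply, dRot_apply, Matrix.one_apply]
  simp only [rotIdx_injective.eq_iff]
  split_ifs with h
  · rw [h, conj_rotPhase_mul_self]
  · simp

lemma dRot_conj_apply {n : ℕ} (A : Op (n + 1)) (δ ε : Sgn (n + 1)) :
    ((dRot (n + 1))⁻¹ * A * dRot (n + 1)) δ ε =
      (starRingEnd ℂ) (rotPhase δ) * A (rotIdx δ) (rotIdx ε) * rotPhase ε := by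
  rw [mul_dRot_apply, inv_dRot, conjTranspose_dRot_mul_apply]

lemma atPos_swap2_apply {m p : ℕ} (h : p + 2 ≤ m) (δ ε : Sgn m) :
    atPos m p swap2 δ ε =
      if (∀ k : Fin m, k.val ≠ p → k.val ≠ p + 1 → δ k = ε k) ∧
        δ ⟨p, by omega⟩ = ε ⟨p + 1, by omega⟩ ∧ δ ⟨p + 1, by omega⟩ = ε ⟨p, by omega⟩
      then 1 else 0 := by
  simp [atPos, swap2, h, ← ite_and, and_comm]

lemma atPos_swap2_apply_of_const {m p : ℕ} (h : p + 2 ≤ m) (δ ε : Sgn m)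
    (hc : (∀ k l, δ k = δ l) ∨ ∀ k l, ε k = ε l) :
    atPos m p swap2 δ ε = if δ = ε then 1 else 0 := by
  rw [atPos_swap2_apply h]
  congr 1
  refine propext ⟨fun ⟨h₀, h₁, h₂⟩ => funext fun k => ?_, ?_⟩
  · by_cases hk : k.val = p
    · have e : k = ⟨p, by omega⟩ := Fin.ext hk
      rw [e]
      rcases hc with hc | hc <;> grind
    · by_cases hk' : k.val = p + 1
      · have e : k = ⟨p + 1, by omega⟩ := Fin.ext hk'
        rw [e]
        rcases hc with hc | hc <;> grind
      · exact h₀ k hk hk'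
  · rintro rfl
    exact ⟨fun _ _ _ => rfl, by rcases hc with hc | hc <;> exact hc _ _,
      by rcases hc with hc | hc <;> exact hc _ _⟩

lemma dRot_conj_atPos_swap2_apply_of_const {n : ℕ} (h : 2 ≤ n + 1) (δ ε : Sgn (n + 1))
    (hc : (∀ k l, δ k = δ l) ∨ ∀ k l, ε k = ε l) :
    ((dRot (n + 1))⁻¹ * atPos (n + 1) 0 swap2 * dRot (n + 1)) δ ε = if δ = ε then 1 else 0 := by
  rw [dRot_conj_apply, atPos_swap2_apply_of_const (by omega) (rotIdx δ) (rotIdx ε)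
    (hc.imp (fun h _ _ => h _ _) fun h _ _ => h _ _)]
  simp only [rotIdx_injective.eq_iff]
  split_ifs with he
  · rw [he, mul_one, conj_rotPhase_mul_self]
  · simp

/-- A matrix agreeing with the identity on constant sign strings is absorbed by the projector. -/
lemma extremalProj_absorbs {m : ℕ} (A : Op m)
    (hA : ∀ δ ε : Sgn m, ((∀ k l, δ k = δ l) ∨ ∀ k l, ε k = ε l) →
      A δ ε = if δ = ε then 1 else 0) :
    extremalProj m * A = extremalProj m ∧ A * extremalProj m = extremalProj m := by
  constructor <;> ext δ ε
  · rw [extremalProj, Matrix.diagonal_mul, Matrix.diagonal_apply]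
    by_cases hc : ∀ k l, δ k = δ l
    · rw [hA δ ε (Or.inl hc)]; simp
    · simp [hc]
  · rw [extremalProj, Matrix.mul_diagonal, Matrix.diagonal_apply]
    by_cases hc : ∀ k l, ε k = ε l
    · rw [hA δ ε (Or.inr hc)]
      by_cases h : δ = ε <;> simp [h]
    · by_cases h : δ = ε <;> simp [h, hc]

lemma tensMor_diagonal_one {a b : ℕ} (f : Sgn a → ℂ) :
    tensMor (Matrix.diagonal f) (1 : Op b) =
      Matrix.diagonal fun δ : Sgn (a + b) => f fun i => δ (Fin.castAdd b i) := by
  ext δ ε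
  simp only [tensMor, Matrix.of_apply, Matrix.diagonal_apply, Matrix.one_apply]
  by_cases h : δ = ε
  · simp [h]
  · rw [if_neg h]
    split_ifs with h₁ h₂ <;> try simp
    refine absurd (funext fun k => ?_) h
    induction k using Fin.addCases with
    | left i => exact congrFun h₁ i
    | right i => exact congrFun h₂ i

lemma tP_two : tP 2 = extremalProj 2 := by
  ext δ ε
  obtain ⟨a, b, rfl⟩ : ∃ a b, δ = ![a, b] := ⟨δ 0, δ 1, by ext i; fin_cases i <;> rfl⟩
  obtain ⟨c, d, rfl⟩ : ∃ c d, ε = ![c, d] := ⟨ε 0, ε 1, by ext i; fin_cases i <;> rfl⟩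
  simp only [tP, Matrix.add_apply, Matrix.smul_apply, dRot_conj_apply (n := 1)]
  cases a <;> cases b <;> cases c <;> cases d <;>
    simp [extremalProj, atPos, Matrix.mul_apply, cupM, capM, cupc, capc, rotPhase, rotIdx, Fin.forall_fin_two] <;> norm_num

lemma tP_succ_eq_extremalProj (m : ℕ) (h : tP (m + 2) = extremalProj (m + 2)) :
    tP (m + 3) = extremalProj (m + 3) := by
  ext δ ε
  rw [tP, h, extremalProj, tensMor_diagonal_one, Matrix.mul_diagonal, Matrix.diagonal_mul,
    atPos_swap2_apply (by omega), extremalProj, Matrix.diagonal_apply]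
  simp only [mul_ite, mul_one, mul_zero, ← ite_and]
  congr 1
  refine propext ⟨?_, ?_⟩
  · rintro ⟨hε, ⟨h₀, h₁, h₂⟩, hδ⟩
    have hεδ : ε 0 = δ 0 := (h₀ 0 (by simp) (by simp)).symm
    have h_lt : ∀ k : Fin (m + 3), k.val < m + 2 → δ k = δ 0 ∧ ε k = δ 0 := fun k hk =>
      ⟨hδ ⟨k, hk⟩ 0, (hε ⟨k, hk⟩ 0).trans hεδ⟩
    have h_all : ∀ k : Fin (m + 3), δ k = δ 0 ∧ ε k = δ 0 := by
      intro k
      by_cases hk : k.val < m + 2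
      · exact h_lt k hk
      · have e : k = ⟨m + 1 + 1, by omega⟩ := Fin.ext (by simp; omega)
        rw [e]
        exact ⟨h₂.trans (h_lt _ (by simp)).2, h₁.symm.trans (h_lt _ (by simp)).1⟩
    exact ⟨funext fun k => (h_all k).1.trans (h_all k).2.symm,
      fun k l => (h_all k).1.trans (h_all l).1.symm⟩
  · rintro ⟨rfl, hδ⟩
    exact ⟨fun _ _ => hδ _ _, ⟨fun _ _ _ => rfl, hδ _ _, hδ _ _⟩, fun _ _ => hδ _ _⟩

lemma tP_eq_extremalProj (m : ℕ) : tP (m + 2) = extremalProj (m + 2) := by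
  induction m with
  | zero => exact tP_two
  | succ m ih => exact tP_succ_eq_extremalProj m ih

/-- `t_m` absorbs all transpositions `σ_j` (`1 ≤ j ≤ m-1`) and the
affine transposition `σ₀ = d_m⁻¹ ∘ σ₁ ∘ d_m`. -/
theorem tP_absorbs_swaps (m : ℕ) (hm : 2 ≤ m) :
    (∀ j : ℕ, 1 ≤ j → j ≤ m - 1 →
      tP m * atPos m (j - 1) swap2 = tP m ∧ atPos m (j - 1) swap2 * tP m = tP m) ∧
    (tP m * ((dRot m)⁻¹ * atPos m 0 swap2 * dRot m) = tP m ∧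
      ((dRot m)⁻¹ * atPos m 0 swap2 * dRot m) * tP m = tP m) := by
  obtain ⟨n, rfl⟩ : ∃ n, m = n + 2 := ⟨m - 2, by omega⟩
  rw [tP_eq_extremalProj]
  exact ⟨fun j h₁ h₂ => extremalProj_absorbs _
      fun δ ε => atPos_swap2_apply_of_const (by omega) δ ε,
    extremalProj_absorbs _ fun δ ε => dRot_conj_atPos_swap2_apply_of_const hm δ ε⟩
end
end

section
/- (Splitting of the tensor product of projectors) For all m, n ≥ 1 one has the orthogonal idempotent decomposition t_m ⊗ t_n = t_{m+n} + e_{m,n} in End(V^{⊗(m+n)}); that is, e_{m,n} is idempotent, t_{m+n} is idempotent, and t_{m+n} ∘ e_{m,n} = e_{m,n} ∘ t_{m+n} = 0. -/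
open Matrix

noncomputable section

/-- A sign string is constant when all its signs agree. -/
def IsConst {m : ℕ} (δ : Sgn m) : Prop := ∀ i j, δ i = δ j

open Classical in
/-- The projection onto the span of the basis vectors whose sign string satisfies `p`. -/
def coordProj {m : ℕ} (p : Sgn m → Prop) : Op m :=
  Matrix.diagonal fun δ => if p δ then 1 else 0

/-- The sign strings whose first `m` and last `n` signs are each constant. -/
def IsBiconst (m n : ℕ) (δ : Sgn (m + n)) : Prop :=
  IsConst (fun i => δ (Fin.castAdd n i)) ∧ IsConst (fun j => δ (Fin.natAdd m j))

theorem coordProj_mul {m : ℕ} (p q : Sgn m → Prop) :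
    coordProj p * coordProj q = coordProj fun δ => p δ ∧ q δ := by
  classical
  unfold coordProj
  rw [Matrix.diagonal_mul_diagonal]
  congr 1
  funext δ
  by_cases hp : p δ <;> by_cases hq : q δ <;> simp [hp, hq]

theorem coordProj_true (m : ℕ) : coordProj (fun _ : Sgn m => True) = 1 := by
  simp [coordProj]

theorem coordProj_false (m : ℕ) : coordProj (fun _ : Sgn m => False) = 0 := by
  simp [coordProj]

open Classical in
theorem coordProj_apply {m : ℕ} (p : Sgn m → Prop) (δ ε : Sgn m) :
    coordProj p δ ε = if δ = ε ∧ p δ then 1 else 0 := by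
  by_cases h : δ = ε <;> simp [coordProj, h]

open Classical in
theorem coordProj_conj_apply {m : ℕ} (p : Sgn m → Prop) (A : Op m) (δ ε : Sgn m) :
    (coordProj p * A * coordProj p) δ ε = if p δ ∧ p ε then A δ ε else 0 := by
  unfold coordProj
  rw [Matrix.mul_diagonal, Matrix.diagonal_mul]
  by_cases hδ : p δ <;> by_cases hε : p ε <;> simp [hδ, hε]

theorem append_ext {m n : ℕ} {δ ε : Sgn (m + n)}
    (h₁ : (fun i => δ (Fin.castAdd n i)) = fun i => ε (Fin.castAdd n i))
    (h₂ : (fun j => δ (Fin.natAdd m j)) = fun j => ε (Fin.natAdd m j)) : δ = ε := by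
  funext k
  refine Fin.addCases (fun i => ?_) (fun j => ?_) k
  · exact congrFun h₁ i
  · exact congrFun h₂ j

theorem tensMor_coordProj {m n : ℕ} (p : Sgn m → Prop) (q : Sgn n → Prop) :
    tensMor (coordProj p) (coordProj q) =
      coordProj fun δ : Sgn (m + n) =>
        p (fun i => δ (Fin.castAdd n i)) ∧ q (fun j => δ (Fin.natAdd m j)) := by
  classical
  ext δ ε
  simp only [tensMor, Matrix.of_apply, coordProj_apply, ← ite_and, mul_ite, mul_one, mul_zero]
  congr 1
  refine propext ⟨?_, ?_⟩
  · rintro ⟨⟨h₂, hq⟩, h₁, hp⟩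
    exact ⟨append_ext h₁ h₂, hp, hq⟩
  · rintro ⟨rfl, hp, hq⟩
    exact ⟨⟨rfl, hq⟩, rfl, hp⟩

theorem cupM_mul_capM_apply (δ ε : Sgn 2) :
    (cupM * capM) δ ε = cupc (δ 0) (δ 1) * capc (ε 0) (ε 1) := by
  simp [Matrix.mul_apply, cupM, capM]

theorem sum_sgn_two (f : Sgn 2 → ℂ) : ∑ δ, f δ = ∑ a, ∑ b, f ![a, b] := by
  rw [← (finTwoArrowEquiv Bool).symm.sum_comp, Fintype.sum_prod_type]
  rfl

theorem op_two_ext {A B : Op 2} (h : ∀ a b c d, A ![a, b] ![c, d] = B ![a, b] ![c, d]) :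
    A = B := by
  ext δ ε
  have hδ : δ = ![δ 0, δ 1] := by ext i; fin_cases i <;> rfl
  have hε : ε = ![ε 0, ε 1] := by ext i; fin_cases i <;> rfl
  rw [hδ, hε]
  exact h _ _ _ _

theorem dRot_two_apply (a b c d : Bool) :
    dRot 2 ![a, b] ![c, d] = if a = d ∧ b = c then (if c then Complex.I else -Complex.I) else 0 := by
  have h : (![a, b] : Sgn 2) = rotIdx ![c, d] ↔ a = d ∧ b = c := by
    rw [funext_iff, Fin.forall_fin_two]
    rfl
  simp only [dRot, Matrix.of_apply, h]
  rfl

theorem dRot_two_det_isUnit : IsUnit (dRot 2).det := by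
  refine Matrix.isUnit_det_of_right_inverse (B := dRot 2 * dRot 2 * dRot 2) ?_
  have hsq : dRot 2 * dRot 2 = Matrix.diagonal fun δ => if δ 0 = δ 1 then -1 else 1 := by
    refine op_two_ext fun a b c d => ?_
    rw [Matrix.mul_apply, sum_sgn_two]
    cases a <;> cases b <;> cases c <;> cases d <;>
      simp [dRot_two_apply]
  rw [← mul_assoc, ← mul_assoc, hsq, mul_assoc, hsq, Matrix.diagonal_mul_diagonal,
    ← Matrix.diagonal_one]
  congr 1
  funext δ
  split_ifs <;> simp

theorem atPos_two_zero (A : Op 2) : atPos 2 0 A = A := by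
  ext δ ε
  have h : ∀ k : Fin 2, k.val ≠ 0 → k.val ≠ 0 + 1 → δ k = ε k := fun k h₀ h₁ => by omega
  simp only [atPos, Matrix.of_apply, dif_pos (le_refl 2), if_pos h, one_mul, zero_add]

theorem isConst_two_iff (a b : Bool) : IsConst (![a, b] : Sgn 2) ↔ a = b := by
  simp only [IsConst, Fin.forall_fin_two]
  simp
  tauto

theorem affine_cup_cap_two :
    (dRot 2)⁻¹ * atPos 2 0 (cupM * capM) * dRot 2 =
      (2 : ℂ) • (coordProj IsConst - 1) - cupM * capM := by
  have key : cupM * capM * dRot 2 =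
      dRot 2 * ((2 : ℂ) • (coordProj IsConst - 1) - cupM * capM) := by
    refine op_two_ext fun a b c d => ?_
    rw [Matrix.mul_apply, Matrix.mul_apply, sum_sgn_two, sum_sgn_two]
    simp only [dRot_two_apply, cupM_mul_capM_apply, Matrix.sub_apply, Matrix.smul_apply,
      coordProj_apply, isConst_two_iff, Fintype.sum_bool]
    cases a <;> cases b <;> cases c <;> cases d <;>
      simp [cupc, capc] <;> ring
  rw [atPos_two_zero, mul_assoc, key, Matrix.nonsing_inv_mul_cancel_left _ _ dRot_two_det_isUnit]

theorem tP_two_s9 : tP 2 = coordProj IsConst := by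
  rw [tP, affine_cup_cap_two, atPos_two_zero]
  module

theorem eP_one_one : eP 1 1 = 1 - coordProj IsConst := by
  change (-(2⁻¹ : ℂ)) • atPos 2 0 (cupM * capM) +
      (-(2⁻¹ : ℂ)) • ((dRot 2)⁻¹ * atPos 2 0 (cupM * capM) * dRot 2) = _
  rw [affine_cup_cap_two, atPos_two_zero]
  module

theorem tP_eq_coordProj : ∀ m, 1 ≤ m → tP m = coordProj IsConst
  | 1, _ => by
    have h : (IsConst : Sgn 1 → Prop) = fun _ => True := by
      funext δ
      exact eq_true fun i j => congrArg δ (Subsingleton.elim i j)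
    rw [h, coordProj_true, tP]
  | 2, _ => tP_two_s9
  | m + 3, _ => by
    classical
    rw [tP, tP_eq_coordProj (m + 2) (by omega), ← coordProj_true 1, tensMor_coordProj]
    ext δ ε
    rw [coordProj_conj_apply, coordProj_apply]
    simp only [and_true, atPos, Matrix.of_apply, dif_pos (le_refl (m + 3)), swap2,
      mul_ite, mul_one, mul_zero, ← ite_and]
    refine if_congr ⟨?_, ?_⟩ rfl rfl
    · rintro ⟨⟨hδ, hε⟩, ⟨h₀, h₁⟩, h⟩
      have hz := h 0 (by simp) (by simp)
      have hδ' : ∀ k : Fin (m + 3), k.val < m + 2 → δ k = δ 0 := fun k hk =>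
        hδ ⟨k, hk⟩ 0
      have hε' : ∀ k : Fin (m + 3), k.val < m + 2 → ε k = ε 0 := fun k hk =>
        hε ⟨k, hk⟩ 0
      have hδl : δ (Fin.last (m + 2)) = δ 0 := by
        rw [hz, ← hε' ⟨m + 1, by omega⟩ (by simp)]
        exact h₁
      have hεl : ε (Fin.last (m + 2)) = ε 0 := by
        rw [← hz, ← hδ' ⟨m + 1, by omega⟩ (by simp)]
        exact h₀.symm
      have hδc : ∀ k, δ k = δ 0 := fun k => by
        rcases Nat.lt_or_ge k (m + 2) with hk | hk
        · exact hδ' k hk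
        · rw [show k = Fin.last (m + 2) from Fin.ext (by simp; omega), hδl]
      have hεc : ∀ k, ε k = ε 0 := fun k => by
        rcases Nat.lt_or_ge k (m + 2) with hk | hk
        · exact hε' k hk
        · rw [show k = Fin.last (m + 2) from Fin.ext (by simp; omega), hεl]
      exact ⟨funext fun k => by rw [hδc, hεc, hz], fun i j => by rw [hδc i, hδc j]⟩
    · rintro ⟨rfl, h⟩
      exact ⟨⟨fun _ _ => h _ _, fun _ _ => h _ _⟩, ⟨h _ _, h _ _⟩, fun _ _ _ => rfl⟩

theorem eP_of_ne (m n : ℕ) (h : ¬(m = 1 ∧ n = 1)) :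
    eP m n = -(tensMor (tP m) (tP n) * atPos (m + n) (m - 1) (cupM * capM) *
      tensMor (tP m) (tP n)) := by
  rw [eP]
  rintro rfl rfl
  exact h ⟨rfl, rfl⟩

theorem tensMor_tP (m n : ℕ) (hm : 1 ≤ m) (hn : 1 ≤ n) :
    tensMor (tP m) (tP n) = coordProj (IsBiconst m n) := by
  rw [tP_eq_coordProj m hm, tP_eq_coordProj n hn, tensMor_coordProj]
  rfl

theorem cupc_mul_capc (a b c d : Bool) :
    cupc a b * capc c d = if a ≠ b ∧ c ≠ d then (if a = c then -1 else 1) else 0 := by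
  cases a <;> cases b <;> cases c <;> cases d <;> simp [cupc, capc]

theorem eP_of_ne_eq_coordProj (m n : ℕ) (hm : 1 ≤ m) (hn : 1 ≤ n) (h : ¬(m = 1 ∧ n = 1)) :
    eP m n = coordProj fun δ => IsBiconst m n δ ∧ ¬IsConst δ := by
  classical
  rw [eP_of_ne m n h, tensMor_tP m n hm hn]
  ext δ ε
  rw [Matrix.neg_apply, coordProj_conj_apply, coordProj_apply]
  obtain ⟨m, rfl⟩ := Nat.exists_eq_add_of_le' hm
  obtain ⟨n, rfl⟩ := Nat.exists_eq_add_of_le' hn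
  by_cases hb : IsBiconst (m + 1) (n + 1) δ ∧ IsBiconst (m + 1) (n + 1) ε
  swap
  · rw [if_neg hb, if_neg, neg_zero]
    rintro ⟨rfl, h₁, -⟩
    exact hb ⟨h₁, h₁⟩
  rw [if_pos hb]
  obtain ⟨⟨hδl, hδr⟩, hεl, hεr⟩ := hb
  set l : Fin (m + 1 + (n + 1)) := Fin.castAdd (n + 1) (Fin.last m)
  set r : Fin (m + 1 + (n + 1)) := Fin.natAdd (m + 1) 0
  have hfst : ∀ γ : Sgn (m + 1 + (n + 1)), IsConst (fun i => γ (Fin.castAdd (n + 1) i)) →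
      ∀ i, γ (Fin.castAdd (n + 1) i) = γ l := fun γ hγ i => hγ i _
  have hsnd : ∀ γ : Sgn (m + 1 + (n + 1)), IsConst (fun j => γ (Fin.natAdd (m + 1) j)) →
      ∀ j, γ (Fin.natAdd (m + 1) j) = γ r := fun γ hγ j => hγ j _
  have hconst : IsConst δ ↔ δ l = δ r := by
    refine ⟨fun hc => hc _ _, fun hlr => ?_⟩
    have hall : ∀ k, δ k = δ l := fun k =>
      Fin.addCases (motive := fun k => δ k = δ l) (hfst δ hδl)
        (fun j => (hsnd δ hδr j).trans hlr.symm) k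
    exact fun i j => (hall i).trans (hall j).symm
  have hentry : atPos (m + 1 + (n + 1)) (m + 1 - 1) (cupM * capM) δ ε =
      (if ∀ k : Fin (m + 1 + (n + 1)), k.val ≠ m → k.val ≠ m + 1 → δ k = ε k then 1 else 0) *
        (cupc (δ l) (δ r) * capc (ε l) (ε r)) := by
    simp only [atPos, Matrix.of_apply]
    rw [dif_pos (by omega), cupM_mul_capM_apply]
    rfl
  rw [hentry, cupc_mul_capc, hconst]
  by_cases heq : δ = ε
  · subst heq
    by_cases hlr : δ l = δ r <;> simp [hlr, hδl, hδr, IsBiconst]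
  · rw [if_neg (c := δ = ε ∧ _) (fun h' => heq h'.1), neg_eq_zero]
    by_contra hne
    obtain ⟨h₁, h₂⟩ := mul_ne_zero_iff.mp hne
    have hagree := of_not_not fun h' => h₁ (if_neg h')
    obtain ⟨hδlr, hεlr⟩ := of_not_not fun h' => h₂ (if_neg h')
    have hor : δ l = ε l ∨ δ r = ε r := by
      rcases Nat.eq_zero_or_pos m with rfl | hm'
      · right
        have := hagree (Fin.natAdd 1 (Fin.last n)) (by simp) (by simp; omega)
        rwa [hsnd δ hδr, hsnd ε hεr] at this
      · left
        have := hagree (Fin.castAdd (n + 1) 0) (by simp; omega) (by simp)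
        rwa [hfst δ hδl, hfst ε hεl] at this
    have hand : δ l = ε l ∧ δ r = ε r := by
      revert hδlr hεlr hor
      cases δ l <;> cases δ r <;> cases ε l <;> cases ε r <;> simp
    refine heq (append_ext (funext fun i => ?_) (funext fun j => ?_))
    · rw [hfst δ hδl, hfst ε hεl, hand.1]
    · rw [hsnd δ hδr, hsnd ε hεr, hand.2]

theorem eP_eq_coordProj (m n : ℕ) (hm : 1 ≤ m) (hn : 1 ≤ n) :
    eP m n = coordProj fun δ => IsBiconst m n δ ∧ ¬IsConst δ := by
  classical
  by_cases h : m = 1 ∧ n = 1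
  · obtain ⟨rfl, rfl⟩ := h
    have hb : ∀ δ, IsBiconst 1 1 δ := fun δ =>
      ⟨fun i j => by rw [Subsingleton.elim i j], fun i j => by rw [Subsingleton.elim i j]⟩
    rw [eP_one_one]
    ext δ ε
    rw [Matrix.sub_apply, coordProj_apply, coordProj_apply, Matrix.one_apply]
    by_cases h₁ : δ = ε <;> by_cases h₂ : IsConst δ <;> simp_all
  · exact eP_of_ne_eq_coordProj m n hm hn h

theorem IsConst.isBiconst {m n : ℕ} {δ : Sgn (m + n)} (h : IsConst δ) : IsBiconst m n δ :=
  ⟨fun _ _ => h _ _, fun _ _ => h _ _⟩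

/-- Splitting of the tensor product of projectors:
`t_m ⊗ t_n = t_{m+n} + e_{m,n}` is an orthogonal decomposition of idempotents. -/
theorem tensor_splitting (m n : ℕ) (hm : 1 ≤ m) (hn : 1 ≤ n) :
    tensMor (tP m) (tP n) = tP (m + n) + eP m n ∧
    eP m n * eP m n = eP m n ∧
    tP (m + n) * tP (m + n) = tP (m + n) ∧
    tP (m + n) * eP m n = 0 ∧ eP m n * tP (m + n) = 0 := by
  classical
  rw [tensMor_tP m n hm hn, tP_eq_coordProj (m + n) (by omega), eP_eq_coordProj m n hm hn]
  simp only [coordProj_mul, and_self]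
  refine ⟨?_, trivial, trivial, ?_, ?_⟩
  · ext δ ε
    rw [Matrix.add_apply]
    simp only [coordProj_apply]
    by_cases hc : IsConst δ <;> simp [hc, IsConst.isBiconst]
  · rw [← coordProj_false]
    congr 1
    funext δ
    exact eq_false fun h => h.2.2 h.1
  · rw [← coordProj_false]
    congr 1
    funext δ
    exact eq_false fun h => h.1.2 h.2
end
end
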